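/- For each n let G_n = Alt(n) be the alternating group on n letters, let S_n ⊆ G_n be a symmetric subset, and let M_n be positive integers with M_n/n → 0 as n → ∞. Then for any functions f_1^n, …, f_{M_n}^n : G_n → ℝ there exists n₀ such that for all n ≥ n₀ there is an orthonormal basis B_n of ℓ²(G_n) consisting of real-valued eigenfunctions of the adjacency operator of Cay(G_n, S_n) such that for every φ ∈ B_n and every i = 1, …, M_n one has |Σ_{g∈G_n} f_i^n(g)|φ(g)|² − (1/|G_n|)·Σ_{g∈G_n} f_i^n(g)| ≤ 192·(log n)/√n · ‖f_i^n‖_{ℓ²}/√(|G_n|). -/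

import Mathlib

open scoped BigOperators

lemma two_point (A B K : ℝ) : ∀ (p : ℕ), (4*p:ℝ) ≤ K →
    ((A+B)^(2*p)+(A-B)^(2*p))/2 ≤ (A^2+K*B^2)^p := by
  have key : ∀ q : ℕ, 0 ≤ A*B*((A+B)^(2*q)-(A-B)^(2*q)) ∧
      A*B*((A+B)^(2*q)-(A-B)^(2*q)) ≤ 2*q*B^2*((A+B)^(2*q)+(A-B)^(2*q)) := by
    intro q
    induction q with
    | zero => simp
    | succ q ih =>
      obtain ⟨h0, h1⟩ := ih
      have hx : 0 ≤ (A+B)^(2*q) := by rw [pow_mul]; positivity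
      have hy : 0 ≤ (A-B)^(2*q) := by rw [pow_mul]; positivity
      have e1 : (A+B)^(2*(q+1)) = (A+B)^(2*q) * (A+B)^2 := by ring
      have e2 : (A-B)^(2*(q+1)) = (A-B)^(2*q) * (A-B)^2 := by ring
      rw [e1, e2]
      generalize (A+B)^(2*q) = x at *
      generalize (A-B)^(2*q) = y at *
      have e3 : A*B*(x*(A+B)^2 - y*(A-B)^2) = (A^2+B^2)*(A*B*(x-y)) + 2*(A^2*B^2*(x+y)) := by ring
      have e4 : x*(A+B)^2 + y*(A-B)^2 = (A^2+B^2)*(x+y) + 2*(A*B*(x-y)) := by ring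
      rw [e3, e4]
      refine ⟨by positivity, ?_⟩
      push_cast
      have h2 := mul_le_mul_of_nonneg_left h1 (by positivity : 0 ≤ A^2+B^2)
      have h3 : 0 ≤ (2*((q:ℝ)+1)*B^2) * (2*(A*B*(x-y))) := by positivity
      have h4 : 0 ≤ 2 * B^2*B^2*(x+y) := by positivity
      nlinarith
  intro p
  induction p with
  | zero => intro _; norm_num
  | succ q ih =>
    intro hK
    push_cast at hK
    have ih := ih (by linarith)
    obtain ⟨h0, h1⟩ := key q
    have hx : 0 ≤ (A+B)^(2*q) := by rw [pow_mul]; positivity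
    have hy : 0 ≤ (A-B)^(2*q) := by rw [pow_mul]; positivity
    have e1 : (A+B)^(2*(q+1)) = (A+B)^(2*q) * (A+B)^2 := by ring
    have e2 : (A-B)^(2*(q+1)) = (A-B)^(2*q) * (A-B)^2 := by ring
    rw [e1, e2, pow_succ (A^2+K*B^2)]
    generalize (A+B)^(2*q) = x at *
    generalize (A-B)^(2*q) = y at *
    have hK0 : 0 ≤ K := le_trans (by positivity) hK
    have e4 : x*(A+B)^2 + y*(A-B)^2 = (A^2+B^2)*(x+y) + 2*(A*B*(x-y)) := by ring
    rw [e4]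
    have h2 := mul_le_mul_of_nonneg_right ih (by positivity : 0 ≤ A^2+K*B^2)
    refine le_trans ?_ h2
    have h5 : 0 ≤ (K - 4*q - 1) * (B^2*(x+y)) := mul_nonneg (by linarith) (by positivity)
    nlinarith

lemma minkowski_aux {Ω : Type*} [Fintype Ω] (u w : Ω → ℝ) (hu : ∀ o, 0 ≤ u o) (hw : ∀ o, 0 ≤ w o)
    (α β N : ℝ) (hα : 0 ≤ α) (hβ : 0 ≤ β) (p : ℕ) (hp : 1 ≤ p)
    (h1 : ∑ o, u o ^ p ≤ N * α ^ p) (h2 : ∑ o, w o ^ p ≤ N * β ^ p) :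
    ∑ o, (u o + w o) ^ p ≤ N * (α + β) ^ p := by
  have zero_case : ∀ u : Ω → ℝ, (∀ o, 0 ≤ u o) → ∑ o, u o ^ p ≤ N * (0:ℝ) ^ p → ∀ o, u o = 0 := by
    intro u hu h o
    rw [zero_pow (by omega), mul_zero] at h
    have := (Finset.sum_eq_zero_iff_of_nonneg (fun o _ => pow_nonneg (hu o) p)).1
      (le_antisymm h (Finset.sum_nonneg (fun o _ => pow_nonneg (hu o) p))) o (Finset.mem_univ _)
    exact pow_eq_zero_iff (by omega) |>.1 this
  rcases hα.eq_or_lt with h | hα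
  · subst h
    have := zero_case u hu h1
    simpa [this] using h2
  rcases hβ.eq_or_lt with h | hβ
  · subst h
    have := zero_case w hw h2
    simpa [this] using h1
  have hs : 0 < α + β := by linarith
  have pt : ∀ o, (u o + w o)^p ≤ (α+β)^p * (α/(α+β) * (u o/α)^p + β/(α+β) * (w o/β)^p) := by
    intro o
    have hu' : u o / α ∈ Set.Ici (0:ℝ) := div_nonneg (hu o) hα.le
    have hw' : w o / β ∈ Set.Ici (0:ℝ) := div_nonneg (hw o) hβ.le
    have := (convexOn_pow (𝕜 := ℝ) p).2 hu' hw' (by positivity : 0 ≤ α/(α+β))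
      (by positivity : 0 ≤ β/(α+β)) (by field_simp)
    simp only [smul_eq_mul] at this
    have e : u o + w o = (α+β) * (α/(α+β) * (u o/α) + β/(α+β) * (w o/β)) := by field_simp
    rw [e, mul_pow]
    exact mul_le_mul_of_nonneg_left this (by positivity)
  calc ∑ o, (u o + w o) ^ p ≤ ∑ o, (α+β)^p * (α/(α+β) * (u o/α)^p + β/(α+β) * (w o/β)^p) :=
        Finset.sum_le_sum (fun o _ => pt o)
    _ = (α+β)^p * (α/(α+β) * ((∑ o, u o^p)/α^p) + β/(α+β) * ((∑ o, w o^p)/β^p)) := by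
        rw [← Finset.mul_sum, Finset.sum_add_distrib, ← Finset.mul_sum, ← Finset.mul_sum,
          Finset.sum_div, Finset.sum_div]
        simp only [div_pow]
    _ ≤ (α+β)^p * (α/(α+β) * N + β/(α+β) * N) := by
        gcongr
        · rw [div_le_iff₀ (by positivity)]; exact h1
        · rw [div_le_iff₀ (by positivity)]; exact h2
    _ = N * (α+β)^p := by field_simp

/-- real value of a sign -/
def sg (x : ℤˣ) : ℝ := ((x : ℤ) : ℝ)

lemma sg_sq (x : ℤˣ) : sg x ^ 2 = 1 := by
  rcases Int.units_eq_one_or x with rfl | rfl <;> simp [sg]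

lemma sg_neg (x : ℤˣ) : sg (-x) = - sg x := by simp [sg]

lemma hyper {ι : Type*} [Fintype ι] [DecidableEq ι] (K : ℝ) (p : ℕ) (hp : 1 ≤ p)
    (hK : (4*p:ℝ) ≤ K) (s : Finset ι) :
    ∀ (a : ι → ι → ℝ) (_ : ∀ i j, a i j = a j i) (_ : ∀ i, a i i = 0) (b : ι → ℝ) (c : ℝ),
    ∑ ε : ι → ℤˣ, (c + ∑ j ∈ s, b j * sg (ε j)
      + ∑ j ∈ s, ∑ l ∈ s, a j l * (sg (ε j) * sg (ε l)))^(2*p)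
      ≤ (Fintype.card (ι → ℤˣ)) * (c^2 + K * ∑ j ∈ s, b j^2
        + 2*K^2 * ∑ j ∈ s, ∑ l ∈ s, a j l^2)^p := by
  have hK0 : 0 ≤ K := le_trans (by positivity) hK
  induction s using Finset.induction_on with
  | empty => intro a _ _ b c; simp [pow_mul, Finset.sum_const]
  | insert m s hm ih =>
    intro a ha ha0 b c
    set A : (ι → ℤˣ) → ℝ := fun ε => c + ∑ j ∈ s, b j * sg (ε j)
      + ∑ j ∈ s, ∑ l ∈ s, a j l * (sg (ε j) * sg (ε l)) with hA
    set B : (ι → ℤˣ) → ℝ := fun ε => b m + ∑ j ∈ s, (2 * a m j) * sg (ε j) with hB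
    have ihA := ih a ha ha0 b c
    have ihB := ih (fun _ _ => 0) (by simp) (by simp) (fun j => 2 * a m j) (b m)
    simp only [zero_mul, Finset.sum_const_zero, add_zero, mul_zero, ne_eq, OfNat.ofNat_ne_zero,
      not_false_eq_true, zero_pow] at ihB
    have eX : ∀ ε : ι → ℤˣ, c + ∑ j ∈ insert m s, b j * sg (ε j)
      + ∑ j ∈ insert m s, ∑ l ∈ insert m s, a j l * (sg (ε j) * sg (ε l))
      = A ε + sg (ε m) * B ε := by
      intro ε
      simp only [hA, hB, Finset.sum_insert hm, Finset.sum_add_distrib, ha0]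
      have : ∑ x ∈ s, a x m * (sg (ε x) * sg (ε m)) = ∑ x ∈ s, a m x * (sg (ε m) * sg (ε x)) :=
        Finset.sum_congr rfl (fun x _ => by rw [ha x m]; ring)
      rw [this]
      have : ∑ x ∈ s, a m x * (sg (ε m) * sg (ε x)) = sg (ε m) * ∑ x ∈ s, a m x * sg (ε x) := by
        rw [Finset.mul_sum]; exact Finset.sum_congr rfl (fun x _ => by ring)
      rw [this]
      have : ∑ x ∈ s, 2 * a m x * sg (ε x) = 2 * ∑ x ∈ s, a m x * sg (ε x) := by
        rw [Finset.mul_sum]; exact Finset.sum_congr rfl (fun x _ => by ring)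
      rw [this]; ring
    have flip_inv : Function.Involutive (fun ε : ι → ℤˣ => Function.update ε m (-ε m)) := by
      intro ε; simp
    have hne : ∀ (ε : ι → ℤˣ), ∀ j ∈ s, Function.update ε m (-ε m) j = ε j := by
      intro ε j hj
      rw [Function.update_of_ne]
      rintro rfl; exact hm hj
    have fA : ∀ ε : ι → ℤˣ, A (Function.update ε m (-ε m)) = A ε := by
      intro ε
      simp only [hA]
      congr 1
      · congr 1
        exact Finset.sum_congr rfl (fun j hj => by rw [hne ε j hj])
      · exact Finset.sum_congr rfl (fun j hj => Finset.sum_congr rfl (fun l hl => by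
          rw [hne ε j hj, hne ε l hl]))
    have fB : ∀ ε : ι → ℤˣ, B (Function.update ε m (-ε m)) = B ε := by
      intro ε
      simp only [hB]
      congr 1
      exact Finset.sum_congr rfl (fun j hj => by rw [hne ε j hj])
    have sym : ∑ ε : ι → ℤˣ, (A ε + sg (ε m) * B ε)^(2*p)
        = ∑ ε : ι → ℤˣ, (A ε - sg (ε m) * B ε)^(2*p) := by
      rw [← Equiv.sum_comp flip_inv.toPerm]
      refine Finset.sum_congr rfl (fun ε _ => ?_)
      simp only [Function.Involutive.coe_toPerm]
      rw [fA, fB]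
      simp [sg_neg, sub_eq_add_neg]
    have step : ∑ ε : ι → ℤˣ, (A ε + sg (ε m) * B ε)^(2*p)
        ≤ ∑ ε : ι → ℤˣ, (A ε ^ 2 + K * B ε ^2)^p := by
      have : ∑ ε : ι → ℤˣ, (A ε + sg (ε m) * B ε)^(2*p) = ∑ ε : ι → ℤˣ,
        ((A ε + sg (ε m) * B ε)^(2*p) + (A ε - sg (ε m) * B ε)^(2*p))/2 := by
        rw [← Finset.sum_div, Finset.sum_add_distrib, ← sym]; ring
      rw [this]
      refine Finset.sum_le_sum (fun ε _ => ?_)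
      have := two_point (A ε) (sg (ε m) * B ε) K p hK
      rwa [mul_pow (sg (ε m)), sg_sq, one_mul] at this
    simp only [eX]
    refine step.trans ?_
    have eN : c ^ 2 + K * ∑ j ∈ insert m s, b j ^ 2 +
            2 * K ^ 2 * ∑ j ∈ insert m s, ∑ l ∈ insert m s, a j l ^ 2
        = (c^2 + K * ∑ j ∈ s, b j^2 + 2*K^2 * ∑ j ∈ s, ∑ l ∈ s, a j l^2)
          + K * (b m ^ 2 + K * ∑ j ∈ s, (2 * a m j)^2) := by
      simp only [Finset.sum_insert hm, Finset.sum_add_distrib, ha0]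
      have : ∑ x ∈ s, a x m ^ 2 = ∑ x ∈ s, a m x ^ 2 :=
        Finset.sum_congr rfl (fun x _ => by rw [ha x m])
      rw [this]
      simp only [mul_pow, ← Finset.mul_sum]
      ring
    rw [eN]
    refine minkowski_aux _ _ (fun o => by positivity) (fun o => by positivity) _ _ _
      ?_ ?_ p hp ?_ ?_
    · have : 0 ≤ ∑ j ∈ s, ∑ l ∈ s, a j l^2 :=
        Finset.sum_nonneg (fun _ _ => Finset.sum_nonneg (fun _ _ => by positivity))
      have : 0 ≤ ∑ j ∈ s, b j^2 := Finset.sum_nonneg (fun _ _ => by positivity)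
      positivity
    · have : 0 ≤ ∑ j ∈ s, (2 * a m j)^2 := Finset.sum_nonneg (fun _ _ => by positivity)
      positivity
    · simpa only [← pow_mul] using ihA
    · simp only [mul_pow K, ← Finset.mul_sum, ← pow_mul (B _)]
      calc _ ≤ K^p * _ := mul_le_mul_of_nonneg_left ihB (by positivity)
        _ = _ := by ring

lemma sign_avg {ι : Type*} [Fintype ι] [DecidableEq ι] (K : ℝ) (p : ℕ) (hp : 1 ≤ p)
    (hK : (4*p:ℝ) ≤ K) (A : Matrix ι ι ℝ) (hA : A.transpose = A) (r T : ℝ) (hr : r ^ 2 = T) :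
    ∑ ε : ι → ℤˣ, ((∑ j, ∑ l, (r * sg (ε j)) * A j l * (r * sg (ε l))) - T * A.trace)^(2*p)
      ≤ (Fintype.card (ι → ℤˣ)) * (2*K^2 * (T^2 * ∑ j, ∑ l, A j l^2))^p := by
  have hK0 : 0 ≤ K := le_trans (by positivity) hK
  have hsym : ∀ i j, A i j = A j i := fun i j => by
    conv_lhs => rw [← hA]
    rfl
  have h := hyper K p hp hK (Finset.univ : Finset ι) (fun j l => if j = l then 0 else T * A j l)
    (by intro i j; simp only [eq_comm, hsym i j]) (by simp) (fun _ => 0) 0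
  simp only [zero_mul, Finset.sum_const_zero, add_zero, mul_zero, ne_eq, OfNat.ofNat_ne_zero,
      not_false_eq_true, zero_pow, zero_add] at h
  have e : ∀ ε : ι → ℤˣ, (∑ j, ∑ l, (r * sg (ε j)) * A j l * (r * sg (ε l))) - T * A.trace
     = ∑ j, ∑ l, (if j = l then 0 else T * A j l) * (sg (ε j) * sg (ε l)) := by
    intro ε
    rw [Matrix.trace, Finset.mul_sum, ← Finset.sum_sub_distrib]
    refine Finset.sum_congr rfl (fun j _ => ?_)
    have : T * A.diag j = ∑ l, if j = l then T * A j l * (sg (ε j) * sg (ε l)) else 0 := by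
      rw [Finset.sum_ite_eq]
      simp only [Finset.mem_univ, if_true, ← sq, sg_sq, mul_one, Matrix.diag]
    rw [this, ← Finset.sum_sub_distrib]
    refine Finset.sum_congr rfl (fun l _ => ?_)
    split_ifs
    · rw [← hr]; ring
    · rw [← hr]; ring
  simp only [e]
  refine h.trans ?_
  have h1 : ∑ j, ∑ l, (if j = l then 0 else T * A j l)^2 ≤ T^2 * ∑ j, ∑ l, A j l^2 := by
    simp only [Finset.mul_sum]
    refine Finset.sum_le_sum (fun j _ => Finset.sum_le_sum (fun l _ => ?_))
    split_ifs
    · have : 0 ≤ T^2 * A j l ^2 := by positivity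
      simpa using this
    · rw [mul_pow]
  have h0 : 0 ≤ ∑ j, ∑ l, (if j = l then 0 else T * A j l)^2 :=
    Finset.sum_nonneg (fun _ _ => Finset.sum_nonneg (fun _ _ => by positivity))
  gcongr

instance orth_compact {ι : Type*} [Fintype ι] [DecidableEq ι] :
    CompactSpace (Matrix.orthogonalGroup ι ℝ) := by
  suffices h : IsCompact ((Matrix.orthogonalGroup ι ℝ : Submonoid _) : Set (Matrix ι ι ℝ)) from
    isCompact_iff_compactSpace.1 h
  have hc : IsCompact (Set.univ.pi (fun _ : ι => Set.univ.pi (fun _ : ι => Set.Icc (-1:ℝ) 1))) :=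
    isCompact_univ_pi (fun _ => isCompact_univ_pi (fun _ => isCompact_Icc))
  refine IsCompact.of_isClosed_subset (X := Matrix ι ι ℝ) hc ?_ ?_
  · have : ((Matrix.orthogonalGroup ι ℝ : Submonoid _) : Set (Matrix ι ι ℝ))
        = {U | U * U.transpose = 1} := by
      ext U; simp [Matrix.mem_orthogonalGroup_iff, Matrix.star_eq_conjTranspose]
    rw [this]
    exact isClosed_eq (by fun_prop) continuous_const
  · intro U hU i _ j _
    have := entry_norm_bound_of_unitary hU i j
    rw [Real.norm_eq_abs] at this
    exact abs_le.1 this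

lemma flat_orth {ι : Type*} [Fintype ι] [DecidableEq ι] [Nonempty ι] (m : ι) (ε : ι → ℤˣ) :
    ∃ R : Matrix.orthogonalGroup ι ℝ, ∀ j, R.1 m j = (Real.sqrt (Fintype.card ι))⁻¹ * sg (ε j) := by
  have hd : (0:ℝ) < Fintype.card ι := by exact_mod_cast Fintype.card_pos
  set v : EuclideanSpace ℝ ι := WithLp.toLp 2 (fun j => (Real.sqrt (Fintype.card ι))⁻¹ * sg (ε j))
    with hv
  have hn : ‖v‖ = 1 := by
    rw [EuclideanSpace.norm_eq, hv]
    simp [mul_pow, sg_sq, Real.sq_sqrt hd.le, hd.ne']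
  obtain ⟨b, hb⟩ := Orthonormal.exists_orthonormalBasis_extension_of_card_eq (𝕜 := ℝ)
    (E := EuclideanSpace ℝ ι) (ι := ι) (by simp) (v := fun _ => v) (s := {m}) (by
      constructor
      · intro i; exact hn
      · intro i j hij
        exact absurd (Subsingleton.elim i j) hij)
  refine ⟨⟨Matrix.of (fun i j => b i j), ?_⟩, ?_⟩
  · rw [Matrix.mem_orthogonalGroup_iff]
    ext i j
    have := orthonormal_iff_ite.1 b.orthonormal i j
    rw [PiLp.inner_apply] at this
    simp only [Matrix.mul_apply, Matrix.star_eq_conjTranspose, Matrix.conjTranspose_apply,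
      Matrix.one_apply, Matrix.of_apply]
    rw [← this]
    refine Finset.sum_congr rfl (fun l _ => ?_)
    simp [mul_comm]
  · intro j
    simp [hb m rfl, hv]

lemma core {ι κ : Type*} [Fintype ι] [DecidableEq ι] [Nonempty ι] [Fintype κ]
    (Q : κ → Matrix ι ι ℝ) (hsym : ∀ i, (Q i).transpose = Q i) (τ : κ → ℝ) (hτ : ∀ i, 0 ≤ τ i)
    (hQ : ∀ i, ∑ j, ∑ l, Q i j l ^2 ≤ Fintype.card ι * τ i) (p : ℕ) (hp : 1 ≤ p) :
    ∃ U ∈ Matrix.orthogonalGroup ι ℝ, ∀ m i,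
      ((U * Q i * U.transpose) m m - (Q i).trace / Fintype.card ι)^(2*p)
        ≤ Fintype.card ι * Fintype.card κ * (2*(4*p)^2*τ i/Fintype.card ι)^p := by
  have hd : (0:ℝ) < Fintype.card ι := by exact_mod_cast Fintype.card_pos
  set d : ℝ := ((Fintype.card ι : ℕ) : ℝ) with hd_def
  let _ : MeasurableSpace (Matrix.orthogonalGroup ι ℝ) := borel _
  have : BorelSpace (Matrix.orthogonalGroup ι ℝ) := ⟨rfl⟩
  let μ : MeasureTheory.Measure (Matrix.orthogonalGroup ι ℝ) :=
    MeasureTheory.Measure.haarMeasure ⊤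
  have : MeasureTheory.IsProbabilityMeasure μ := ⟨MeasureTheory.Measure.haarMeasure_self⟩
  let D : ι → κ → Matrix.orthogonalGroup ι ℝ → ℝ := fun m i U =>
    ((U.1 * Q i * U.1.transpose) m m - (Q i).trace / d)^(2*p)
  have hDc : ∀ m i, Continuous (D m i) := by
    intro m i
    have h1 : Continuous (fun U : Matrix.orthogonalGroup ι ℝ => U.1 * Q i * U.1.transpose) := by
      fun_prop
    have h2 : Continuous (fun U : Matrix.orthogonalGroup ι ℝ => (U.1 * Q i * U.1.transpose) m m) :=
      h1.matrix_elem m m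
    exact (h2.sub continuous_const).pow _
  have hint : ∀ F : Matrix.orthogonalGroup ι ℝ → ℝ, Continuous F → MeasureTheory.Integrable F μ := by
    intro F hF
    exact hF.integrable_of_hasCompactSupport (HasCompactSupport.of_compactSpace F)
  have hDnn : ∀ m i U, 0 ≤ D m i U := fun m i U => by
    simp only [D]; rw [pow_mul]; positivity
  have hN : (0:ℝ) < Fintype.card (ι → ℤˣ) := by exact_mod_cast Fintype.card_pos
  have hb : ∀ m i, ∫ U, D m i U ∂μ ≤ (2*(4*p)^2*τ i/d)^p := by
    intro m i
    choose R hR using flat_orth (ι := ι) m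
    have h1 : ∀ ε, ∫ U, D m i (R ε * U) ∂μ = ∫ U, D m i U ∂μ := fun ε =>
      MeasureTheory.integral_mul_left_eq_self _ _
    have h2 : ∀ U, ∑ ε, D m i (R ε * U) ≤ Fintype.card (ι → ℤˣ) * (2*(4*p)^2*τ i/d)^p := by
      intro U
      set A := U.1 * Q i * U.1.transpose with hA
      have hUU : U.1.transpose * U.1 = 1 := by
        have := (Matrix.mem_orthogonalGroup_iff' ι ℝ).1 U.2
        simpa [Matrix.star_eq_conjTranspose] using this
      have hAt : A.transpose = A := by
        simp [hA, Matrix.transpose_mul, hsym i, Matrix.mul_assoc]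
      have htr : A.trace = (Q i).trace := by
        rw [hA, Matrix.trace_mul_comm, ← Matrix.mul_assoc, hUU, Matrix.one_mul]
      have hsq : ∀ B : Matrix ι ι ℝ, ∑ j, ∑ l, B j l ^2 = (B * B.transpose).trace := by
        intro B
        simp [Matrix.trace, Matrix.mul_apply, sq]
      have hAs : ∑ j, ∑ l, A j l ^2 = ∑ j, ∑ l, Q i j l ^2 := by
        rw [hsq, hsq, hAt, hsym i]
        have : A * A = U.1 * (Q i * Q i) * U.1.transpose := by
          rw [hA]
          calc _ = U.1 * Q i * (U.1.transpose * U.1) * Q i * U.1.transpose := by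
                simp only [Matrix.mul_assoc]
            _ = _ := by rw [hUU]; simp only [Matrix.mul_assoc, Matrix.mul_one, Matrix.one_mul]
        rw [this, Matrix.trace_mul_comm, ← Matrix.mul_assoc, hUU, Matrix.one_mul]
      have e : ∀ ε, D m i (R ε * U) =
        ((∑ j, ∑ l, ((Real.sqrt d)⁻¹ * sg (ε j)) * A j l * ((Real.sqrt d)⁻¹ * sg (ε l)))
          - d⁻¹ * A.trace)^(2*p) := by
        intro ε
        simp only [D]
        have : ((R ε * U : Matrix.orthogonalGroup ι ℝ)).1 * Q i * ((R ε * U : Matrix.orthogonalGroup ι ℝ)).1.transpose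
          = (R ε).1 * A * (R ε).1.transpose := by
          simp [hA, Matrix.transpose_mul, Matrix.mul_assoc]
        rw [this, htr, Matrix.mul_apply]
        congr 1
        rw [div_eq_inv_mul]
        congr 1
        rw [Finset.sum_comm]
        refine Finset.sum_congr rfl (fun l _ => ?_)
        rw [Matrix.mul_apply, Finset.sum_mul]
        refine Finset.sum_congr rfl (fun j _ => ?_)
        rw [Matrix.transpose_apply, hR, hR]
      simp only [e]
      refine (sign_avg (4*p) p hp le_rfl A hAt (Real.sqrt d)⁻¹ d⁻¹
        (by rw [inv_pow, Real.sq_sqrt hd.le])).trans ?_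
      have h0 : 0 ≤ ∑ j, ∑ l, A j l^2 :=
        Finset.sum_nonneg (fun _ _ => Finset.sum_nonneg (fun _ _ => by positivity))
      have h3 : 2 * (4*(p:ℝ))^2 * (d⁻¹^2 * ∑ j, ∑ l, A j l^2) ≤ 2*(4*p)^2*τ i/d := by
        rw [hAs]
        calc _ ≤ 2 * (4*(p:ℝ))^2 * (d⁻¹^2 * (d * τ i)) := by gcongr; exact hQ i
          _ = _ := by field_simp
      gcongr
    have h3 : (Fintype.card (ι → ℤˣ) : ℝ) * ∫ U, D m i U ∂μ
        ≤ Fintype.card (ι → ℤˣ) * (2*(4*p)^2*τ i/d)^p := by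
      calc (Fintype.card (ι → ℤˣ) : ℝ) * ∫ U, D m i U ∂μ
          = ∑ ε : ι → ℤˣ, ∫ U, D m i (R ε * U) ∂μ := by
            simp only [h1]; simp
        _ = ∫ U, ∑ ε : ι → ℤˣ, D m i (R ε * U) ∂μ := by
            rw [MeasureTheory.integral_finsetSum]
            intro ε _
            exact hint _ ((hDc m i).comp (continuous_const_mul (R ε)))
        _ ≤ ∫ U, (Fintype.card (ι → ℤˣ) * (2*(4*p)^2*τ i/d)^p : ℝ) ∂μ := by
            refine MeasureTheory.integral_mono (hint _ ?_) (MeasureTheory.integrable_const _) h2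
            exact continuous_finsetSum _ (fun ε _ => (hDc m i).comp (continuous_const_mul (R ε)))
        _ = _ := by simp
    exact le_of_mul_le_mul_left h3 hN
  let w : κ → ℝ := fun i => ((2*(4*p)^2*τ i/d)^p)⁻¹
  have hw : ∀ i, 0 ≤ w i := fun i => by
    have := hτ i
    simp only [w]; positivity
  let F : Matrix.orthogonalGroup ι ℝ → ℝ := fun U => ∑ m, ∑ i, w i * D m i U
  have hFc : Continuous F := by
    refine continuous_finsetSum _ (fun m _ => continuous_finsetSum _ (fun i _ => ?_))
    exact continuous_const.mul (hDc m i)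
  have hFi : ∫ U, F U ∂μ ≤ d * Fintype.card κ := by
    simp only [F]
    have hc1 : ∀ m i, Continuous (fun U => w i * D m i U) := fun m i =>
      continuous_const.mul (hDc m i)
    have hc2 : ∀ m, Continuous (fun U => ∑ i, w i * D m i U) := fun m =>
      continuous_finsetSum _ (fun i _ => hc1 m i)
    rw [MeasureTheory.integral_finsetSum _ (fun m _ => hint _ (hc2 m))]
    calc _ ≤ ∑ m : ι, (Fintype.card κ : ℝ) := by
          refine Finset.sum_le_sum (fun m _ => ?_)
          rw [MeasureTheory.integral_finsetSum _ (fun i _ => hint _ (hc1 m i))]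
          calc _ ≤ ∑ i : κ, (1:ℝ) := by
                refine Finset.sum_le_sum (fun i _ => ?_)
                rw [MeasureTheory.integral_const_mul]
                calc _ ≤ w i * (2*(4*p)^2*τ i/d)^p := mul_le_mul_of_nonneg_left (hb m i) (hw i)
                  _ ≤ 1 := inv_mul_le_one
            _ = _ := by simp
      _ = _ := by simp [hd_def]
  obtain ⟨U, hU⟩ := MeasureTheory.exists_le_integral (hint F hFc)
  refine ⟨U.1, U.2, fun m i => ?_⟩
  rcases (hτ i).eq_or_lt with h0 | hpos
  · have hz : ∑ j, ∑ l, Q i j l ^2 ≤ 0 := by simpa [← h0] using hQ i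
    have hQ0 : Q i = 0 := by
      ext j l
      have h5 := (Finset.sum_eq_zero_iff_of_nonneg (fun j _ => Finset.sum_nonneg
        (fun l _ => sq_nonneg (Q i j l)))).1 (le_antisymm hz (Finset.sum_nonneg (fun _ _ =>
          Finset.sum_nonneg (fun _ _ => sq_nonneg _)))) j (Finset.mem_univ _)
      have h6 := (Finset.sum_eq_zero_iff_of_nonneg (fun l _ => sq_nonneg (Q i j l))).1 h5 l
        (Finset.mem_univ _)
      simpa using h6
    have : (p:ℕ) ≠ 0 := by omega
    simp [hQ0, ← h0, this]
  · have h5 : w i * D m i U ≤ d * Fintype.card κ := by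
      refine le_trans ?_ (hU.trans hFi)
      simp only [F]
      refine le_trans ?_ (Finset.single_le_sum (f := fun m => ∑ i, w i * D m i U)
        (fun m _ => Finset.sum_nonneg (fun i _ => mul_nonneg (hw i) (hDnn m i U)))
        (Finset.mem_univ m))
      exact Finset.single_le_sum (f := fun i => w i * D m i U)
        (fun i _ => mul_nonneg (hw i) (hDnn m i U)) (Finset.mem_univ i)
    have hp0 : (0:ℝ) < p := by exact_mod_cast hp
    have h6 : 0 < (2*(4*(p:ℝ))^2*τ i/d)^p := by positivity
    simp only [w] at h5
    rw [inv_mul_le_iff₀ h6] at h5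
    calc _ = D m i U := rfl
      _ ≤ _ := h5
      _ = _ := by ring

section Grp
variable {G : Type*} [Group G] [Fintype G]

/-- left translation -/
def tr (h : G) : EuclideanSpace ℝ G →ₗ[ℝ] EuclideanSpace ℝ G where
  toFun v := WithLp.toLp 2 (fun g => v (h * g))
  map_add' u v := by ext g; simp
  map_smul' c v := by ext g; simp

lemma tr_apply (h : G) (v : EuclideanSpace ℝ G) (g : G) : tr h v g = v (h * g) := rfl

lemma tr_tr (a b : G) (v : EuclideanSpace ℝ G) : tr a (tr b v) = tr (b * a) v := by
  ext g; simp [tr_apply, mul_assoc]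

lemma tr_one (v : EuclideanSpace ℝ G) : tr 1 v = v := by
  ext g; simp [tr_apply]

lemma inner_eq (u v : EuclideanSpace ℝ G) : inner ℝ u v = ∑ g, u g * v g := by
  rw [PiLp.inner_apply]
  exact Finset.sum_congr rfl (fun g _ => by simp [mul_comm])

lemma inner_tr (h : G) (u v : EuclideanSpace ℝ G) :
    inner ℝ (tr h u) v = inner ℝ u (tr h⁻¹ v) := by
  rw [inner_eq, inner_eq, ← Equiv.sum_comp (Equiv.mulLeft h⁻¹)]
  exact Finset.sum_congr rfl (fun g _ => by simp [tr_apply])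

lemma norm_tr (h : G) (u : EuclideanSpace ℝ G) : ‖tr h u‖ = ‖u‖ := by
  have : inner ℝ (tr h u) (tr h u) = inner ℝ u u := by
    rw [inner_tr, tr_tr]; simp [tr_one]
  rw [real_inner_self_eq_norm_sq, real_inner_self_eq_norm_sq] at this
  exact (sq_eq_sq₀ (norm_nonneg _) (norm_nonneg _)).1 this

/-- translation-invariant subspaces -/
def TInv (V : Submodule ℝ (EuclideanSpace ℝ G)) : Prop := ∀ h : G, ∀ v ∈ V, tr h v ∈ V

lemma sum_sq_basis (V : Submodule ℝ (EuclideanSpace ℝ G)) (hV : TInv V) {ι : Type*} [Fintype ι]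
    (e : OrthonormalBasis ι ℝ V) (g : G) :
    ∑ k, (e k : EuclideanSpace ℝ G) g ^ 2 = Fintype.card ι / Fintype.card G := by
  have hG : (0:ℝ) < Fintype.card G := by exact_mod_cast Fintype.card_pos
  let u : G → V := fun g => ∑ k, ((e k : EuclideanSpace ℝ G) g) • e k
  have hrep : ∀ (v : V) (g : G), (v : EuclideanSpace ℝ G) g = inner ℝ (u g) v := by
    intro v g
    have h1 : (v : EuclideanSpace ℝ G) g
      = ∑ k, inner ℝ (e k) v * (e k : EuclideanSpace ℝ G) g := by
      conv_lhs => rw [← e.sum_repr' v]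
      simp
    rw [h1, sum_inner]
    refine Finset.sum_congr rfl (fun k _ => ?_)
    rw [mul_comm]
    exact (real_inner_smul_left (e k) v _).symm
  have hself : ∀ g, (u g : EuclideanSpace ℝ G) g = ∑ k, (e k : EuclideanSpace ℝ G) g ^ 2 := by
    intro g
    simp [u, sq]
  have hn : ∀ g, ‖u g‖^2 = ∑ k, (e k : EuclideanSpace ℝ G) g ^ 2 := by
    intro g
    rw [← hself, hrep, real_inner_self_eq_norm_sq]
  have hle : ∀ a b, ‖u a‖ ≤ ‖u b‖ := by
    intro a b
    -- translate
    let w : V := ⟨tr (a * b⁻¹) (u a), hV _ _ (u a).2⟩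
    have h1 : (w : EuclideanSpace ℝ G) b = ‖u a‖^2 := by
      rw [hn, ← hself]
      simp [w, tr_apply]
    have h2 : ‖w‖ = ‖u a‖ := norm_tr _ _
    have h3 := real_inner_le_norm (u b) w
    rw [← hrep, h1, h2] at h3
    rcases (norm_nonneg (u a)).eq_or_lt with h | h
    · rw [← h]; exact norm_nonneg _
    · rw [sq] at h3
      exact le_of_mul_le_mul_right h3 h
  have hconst : ∀ a b, ∑ k, (e k : EuclideanSpace ℝ G) a ^ 2 = ∑ k, (e k : EuclideanSpace ℝ G) b ^ 2 := by
    intro a b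
    rw [← hn, ← hn, le_antisymm (hle a b) (hle b a)]
  have hsum : ∑ a : G, ∑ k, (e k : EuclideanSpace ℝ G) a ^ 2 = Fintype.card ι := by
    rw [Finset.sum_comm]
    have : ∀ k, ∑ a : G, (e k : EuclideanSpace ℝ G) a ^ 2 = 1 := by
      intro k
      have h1 : inner ℝ (e k : EuclideanSpace ℝ G) (e k) = 1 := by
        rw [real_inner_self_eq_norm_sq]
        have := e.orthonormal.1 k
        rw [show ‖(e k : EuclideanSpace ℝ G)‖ = 1 from this]; norm_num
      rw [inner_eq] at h1
      simpa [sq] using h1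
    simp [this]
  rw [eq_div_iff hG.ne', ← hsum, Finset.sum_congr rfl (fun a _ => hconst a g)]
  simp [mul_comm]

lemma block (V : Submodule ℝ (EuclideanSpace ℝ G)) (hV : TInv V) {κ : Type*} [Fintype κ]
    (d : ℕ) (hd : Module.finrank ℝ V = d) (hd0 : 0 < d)
    (f : κ → G → ℝ) (p : ℕ) (hp : 1 ≤ p) :
    ∃ b : OrthonormalBasis (Fin d) ℝ V, ∀ k i,
      (∑ g, f i g * (b k : EuclideanSpace ℝ G) g ^ 2 - (∑ g, f i g) / Fintype.card G) ^ (2*p)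
      ≤ d * Fintype.card κ * (2*(4*p)^2*((∑ g, f i g ^ 2) / Fintype.card G)/d)^p := by
  have hG : (0:ℝ) < Fintype.card G := by exact_mod_cast Fintype.card_pos
  have hdr : (0:ℝ) < d := by exact_mod_cast hd0
  have : Nonempty (Fin d) := ⟨⟨0, hd0⟩⟩
  let e : OrthonormalBasis (Fin d) ℝ V := (stdOrthonormalBasis ℝ V).reindex (finCongr hd)
  have hss := sum_sq_basis V hV e
  simp only [Fintype.card_fin] at hss
  let Q : κ → Matrix (Fin d) (Fin d) ℝ := fun i => Matrix.of (fun k l =>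
    ∑ g, f i g * ((e k : EuclideanSpace ℝ G) g * (e l : EuclideanSpace ℝ G) g))
  have hsym : ∀ i, (Q i).transpose = Q i := by
    intro i; ext k l
    simp only [Q, Matrix.transpose_apply, Matrix.of_apply]
    exact Finset.sum_congr rfl (fun g _ => by ring)
  have htr : ∀ i, (Q i).trace / d = (∑ g, f i g) / Fintype.card G := by
    intro i
    simp only [Q, Matrix.trace, Matrix.diag, Matrix.of_apply]
    rw [Finset.sum_comm]
    simp only [← Finset.mul_sum, ← sq, hss, ← Finset.sum_mul]
    field_simp
  have hQ : ∀ i, ∑ k, ∑ l, Q i k l ^2 ≤ (Fintype.card (Fin d) : ℝ) * ((∑ g, f i g ^ 2) / Fintype.card G) := by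
    intro i
    have h1 : ∀ k, ∑ l, Q i k l ^2 ≤ ∑ g, f i g ^2 * (e k : EuclideanSpace ℝ G) g ^ 2 := by
      intro k
      let x : EuclideanSpace ℝ G := WithLp.toLp 2 (fun g => f i g * (e k : EuclideanSpace ℝ G) g)
      have ho : Orthonormal ℝ (fun l => (e l : EuclideanSpace ℝ G)) :=
        e.orthonormal.comp_linearIsometry V.subtypeₗᵢ
      have hB := ho.sum_inner_products_le x (s := Finset.univ)
      have hx : ‖x‖^2 = ∑ g, f i g ^2 * (e k : EuclideanSpace ℝ G) g ^ 2 := by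
        rw [← real_inner_self_eq_norm_sq, inner_eq]
        exact Finset.sum_congr rfl (fun g _ => by simp only [x]; ring)
      rw [hx] at hB
      refine le_trans (le_of_eq ?_) hB
      refine Finset.sum_congr rfl (fun l _ => ?_)
      rw [Real.norm_eq_abs, sq_abs, inner_eq]
      simp only [Q, Matrix.of_apply, x]
      congr 1
      exact Finset.sum_congr rfl (fun g _ => by ring)
    refine (Finset.sum_le_sum (fun k _ => h1 k)).trans (le_of_eq ?_)
    rw [Finset.sum_comm]
    simp only [← Finset.mul_sum, hss, ← Finset.sum_mul, Fintype.card_fin]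
    ring
  obtain ⟨U, hU, hbound⟩ := core Q hsym (fun i => (∑ g, f i g ^ 2) / Fintype.card G)
    (fun i => by have : 0 ≤ ∑ g, f i g ^ 2 := Finset.sum_nonneg (fun _ _ => sq_nonneg _)
                 positivity) hQ p hp
  let v : Fin d → V := fun m => ∑ k, U m k • e k
  have hUU : U * U.transpose = 1 := by
    have := (Matrix.mem_orthogonalGroup_iff (Fin d) ℝ).1 hU
    simpa [Matrix.star_eq_conjTranspose] using this
  have hv : Orthonormal ℝ v := by
    rw [orthonormal_iff_ite]
    intro i j
    simp only [v]
    rw [e.orthonormal.inner_sum]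
    have := congrFun (congrFun hUU i) j
    rw [Matrix.mul_apply, Matrix.one_apply] at this
    rw [← this]
    simp
  obtain ⟨b, hb⟩ := Orthonormal.exists_orthonormalBasis_extension_of_card_eq (𝕜 := ℝ) (E := V)
    (ι := Fin d) (by simp [hd]) (v := v) (s := Set.univ)
    (hv.comp _ Subtype.val_injective)
  refine ⟨b, fun k i => ?_⟩
  have := hbound k i
  simp only [Fintype.card_fin, htr] at this
  convert this using 3
  rw [hb k (Set.mem_univ _), Matrix.mul_apply]
  simp only [Matrix.mul_apply, Q, Matrix.of_apply, Matrix.transpose_apply]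
  have hvg : ∀ g, (v k : EuclideanSpace ℝ G) g = ∑ l, U k l * (e l : EuclideanSpace ℝ G) g := by
    intro g; simp [v]
  simp only [hvg, sq, Finset.sum_mul, Finset.mul_sum]
  rw [Finset.sum_comm]
  refine Finset.sum_congr rfl (fun l _ => ?_)
  rw [Finset.sum_comm]
  refine Finset.sum_congr rfl (fun m _ => ?_)
  refine Finset.sum_congr rfl (fun g _ => ?_)
  ring

/-- adjacency operator -/
def adj (S : Finset G) : EuclideanSpace ℝ G →ₗ[ℝ] EuclideanSpace ℝ G where
  toFun v := WithLp.toLp 2 (fun g => ∑ s ∈ S, v (g * s))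
  map_add' u v := by ext g; simp [Finset.sum_add_distrib]
  map_smul' c v := by ext g; simp [Finset.mul_sum]

lemma adj_apply (S : Finset G) (v : EuclideanSpace ℝ G) (g : G) :
    adj S v g = ∑ s ∈ S, v (g * s) := rfl

lemma adj_tr (S : Finset G) (h : G) (v : EuclideanSpace ℝ G) :
    adj S (tr h v) = tr h (adj S v) := by
  ext g; simp [adj_apply, tr_apply, mul_assoc]

lemma adj_symm (S : Finset G) (hS : ∀ s ∈ S, s⁻¹ ∈ S) : (adj S).IsSymmetric := by
  intro u v
  rw [inner_eq, inner_eq]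
  simp only [adj_apply, Finset.sum_mul, Finset.mul_sum]
  rw [Finset.sum_comm, Finset.sum_comm (s := Finset.univ)]
  refine Finset.sum_bij' (fun s _ => s⁻¹) (fun s _ => s⁻¹) hS hS (by simp) (by simp) ?_
  intro s _
  rw [← Equiv.sum_comp (Equiv.mulRight s⁻¹)]
  exact Finset.sum_congr rfl (fun g _ => by simp)

lemma decomp (S : Finset G) (hS : ∀ s ∈ S, s⁻¹ ∈ S) (P : EuclideanSpace ℝ G → Prop)
    (hblock : ∀ V : Submodule ℝ (EuclideanSpace ℝ G), V ≠ ⊥ → TInv V →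
      (∀ W ≤ V, TInv W → W = ⊥ ∨ W = V) → (∃ μ : ℝ, ∀ v ∈ V, adj S v = μ • v) →
      ∃ s : Set (EuclideanSpace ℝ G), Orthonormal ℝ ((↑) : s → EuclideanSpace ℝ G) ∧
        Submodule.span ℝ s = V ∧ ∀ v ∈ s, P v) :
    ∃ s : Set (EuclideanSpace ℝ G), Orthonormal ℝ ((↑) : s → EuclideanSpace ℝ G) ∧
        Submodule.span ℝ s = ⊤ ∧ ∀ v ∈ s, P v := by
  suffices H : ∀ N : ℕ, ∀ W : Submodule ℝ (EuclideanSpace ℝ G), Module.finrank ℝ W = N → TInv W →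
      (∀ v ∈ W, adj S v ∈ W) → ∃ s : Set (EuclideanSpace ℝ G),
        Orthonormal ℝ ((↑) : s → EuclideanSpace ℝ G) ∧
        Submodule.span ℝ s = W ∧ ∀ v ∈ s, P v from
    H _ ⊤ rfl (fun _ _ _ => trivial) (fun _ _ => trivial)
  intro N
  induction N using Nat.strong_induction_on with
  | _ N ih =>
  intro W hN hW hWA
  by_cases hW0 : W = ⊥
  · refine ⟨∅, ?_, by simp [hW0], by simp⟩
    exact ⟨fun i => i.2.elim, fun i => i.2.elim⟩
  obtain ⟨V, hVmin⟩ := exists_minimal_of_wellFoundedLT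
    (fun V : Submodule ℝ (EuclideanSpace ℝ G) => V ≠ ⊥ ∧ V ≤ W ∧ TInv V ∧ ∀ v ∈ V, adj S v ∈ V)
    ⟨W, hW0, le_rfl, hW, hWA⟩
  obtain ⟨⟨hV0, hVW, hV, hVA⟩, hmin⟩ := hVmin
  -- an eigenvalue on V
  have hsymV : ((adj S).restrict hVA).IsSymmetric := (adj_symm S hS).restrict_invariant hVA
  have hpos : 0 < Module.finrank ℝ V := by
    rw [Module.finrank_pos_iff]; exact Submodule.nontrivial_iff_ne_bot.2 hV0
  have hev := hsymV.hasEigenvalue_eigenvalues rfl ⟨0, hpos⟩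
  obtain ⟨μ, hμ⟩ : ∃ μ : ℝ, Module.End.HasEigenvalue ((adj S).restrict hVA) μ := ⟨_, hev⟩
  obtain ⟨v0, hv0⟩ := hμ.exists_hasEigenvector
  have hμV : ∀ v ∈ V, adj S v = μ • v := by
    have h1 : V ≤ V ⊓ LinearMap.ker (adj S - μ • LinearMap.id) := by
      apply hmin
      · refine ⟨?_, inf_le_left.trans hVW, ?_, ?_⟩
        · intro hbot
          have h2 := hv0.apply_eq_smul
          have : (v0 : EuclideanSpace ℝ G) ∈ V ⊓ LinearMap.ker (adj S - μ • LinearMap.id) := by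
            refine ⟨v0.2, ?_⟩
            rw [SetLike.mem_coe, LinearMap.mem_ker]
            have := congrArg Subtype.val h2
            simp only [LinearMap.restrict_coe_apply, Submodule.coe_smul] at this
            simp [this]
          rw [hbot, Submodule.mem_bot] at this
          exact hv0.2 (Subtype.ext this)
        · rintro h v ⟨hv1, hv2⟩
          refine ⟨hV h v hv1, ?_⟩
          simp only [SetLike.mem_coe, LinearMap.mem_ker, LinearMap.sub_apply, LinearMap.smul_apply, LinearMap.id_apply,
            sub_eq_zero] at hv2 ⊢
          rw [adj_tr, hv2, map_smul]
        · rintro v ⟨hv1, hv2⟩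
          refine ⟨hVA v hv1, ?_⟩
          simp only [SetLike.mem_coe, LinearMap.mem_ker, LinearMap.sub_apply, LinearMap.smul_apply, LinearMap.id_apply,
            sub_eq_zero] at hv2 ⊢
          rw [hv2, map_smul, hv2]
      · exact inf_le_left
    intro v hv
    have := (h1 hv).2
    simpa [sub_eq_zero] using this
  obtain ⟨s, hs, hsV, hsP⟩ := hblock V hV0 hV (by
    intro W' hW' hinv
    by_cases h0 : W' = ⊥
    · exact Or.inl h0
    · refine Or.inr (le_antisymm hW' (hmin ⟨h0, hW'.trans hVW, hinv, ?_⟩ hW'))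
      intro v hv
      rw [hμV v (hW' hv)]
      exact W'.smul_mem _ hv) ⟨μ, hμV⟩
  obtain ⟨t, ht, htV, htP⟩ := ih (Module.finrank ℝ (W ⊓ Vᗮ : Submodule ℝ (EuclideanSpace ℝ G))) (by
      rw [← hN]
      apply Submodule.finrank_lt_finrank_of_lt
      refine lt_of_le_of_ne inf_le_left (fun h => hV0 ?_)
      have : V ≤ Vᗮ := (hVW.trans h.ge).trans inf_le_right
      rw [eq_bot_iff]
      intro v hv
      have := this hv
      rw [Submodule.mem_orthogonal] at this
      simpa using this v hv) (W ⊓ Vᗮ) rfl (by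
      rintro h v ⟨hv1, hv2⟩
      refine ⟨hW h v hv1, ?_⟩
      rw [SetLike.mem_coe, Submodule.mem_orthogonal'] at hv2 ⊢
      intro u hu
      rw [inner_tr]
      exact hv2 _ (hV _ _ hu)) (by
      rintro v ⟨hv1, hv2⟩
      refine ⟨hWA v hv1, ?_⟩
      rw [SetLike.mem_coe, Submodule.mem_orthogonal'] at hv2 ⊢
      intro u hu
      rw [adj_symm S hS]
      exact hv2 _ (hVA _ hu))
  refine ⟨s ∪ t, ?_, ?_, ?_⟩
  · have hst : ∀ x ∈ s, ∀ y ∈ t, inner ℝ x y = 0 := by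
      intro x hx y hy
      have h1 : x ∈ V := hsV ▸ Submodule.subset_span hx
      have h2 : y ∈ W ⊓ Vᗮ := htV ▸ Submodule.subset_span hy
      exact (Submodule.mem_orthogonal _ _).1 h2.2 x h1
    constructor
    · rintro ⟨x, hx | hx⟩
      · exact hs.1 ⟨x, hx⟩
      · exact ht.1 ⟨x, hx⟩
    · rintro ⟨x, hx⟩ ⟨y, hy⟩ hxy
      have hxy' : x ≠ y := fun h => hxy (Subtype.ext h)
      rcases hx with hx | hx <;> rcases hy with hy | hy
      · exact hs.2 (i := ⟨x, hx⟩) (j := ⟨y, hy⟩) (fun h => hxy' (congrArg Subtype.val h))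
      · exact hst x hx y hy
      · show inner ℝ x y = 0
        rw [real_inner_comm]; exact hst y hy x hx
      · exact ht.2 (i := ⟨x, hx⟩) (j := ⟨y, hy⟩) (fun h => hxy' (congrArg Subtype.val h))
  · rw [Submodule.span_union, hsV, htV, inf_comm]
    exact Submodule.sup_orthogonal_inf_of_hasOrthogonalProjection hVW
  · rintro v (hv | hv)
    · exact hsP v hv
    · exact htP v hv

end Grp

lemma exists_elem_abelian (n : ℕ) : ∃ x : Finset (Fin (n/4)) → alternatingGroup (Fin n),
    Function.Injective x ∧ x ∅ = 1 ∧ (∀ i I, i ∉ I → x (insert i I) = x {i} * x I) ∧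
    (∀ I J, x I * x J = x J * x I) ∧ ∀ I, x I * x I = 1 := by
  classical
  let c : Equiv.Perm (Fin 4) := finRotate 4
  have hc4 : (c ^ 2) * (c ^ 2) = 1 := by decide
  have hc2 : c ^ 2 ≠ 1 := by decide
  let emb : (Σ _ : Fin (n/4), Fin 4) ↪ Fin n :=
    ⟨fun q => ⟨4 * q.1.1 + q.2.1, by have := q.1.2; have := q.2.2; omega⟩, by
      rintro ⟨a, b⟩ ⟨a', b'⟩ h
      simp only [Fin.mk.injEq] at h
      have := b.2
      have := b'.2
      have h1 : a = a' := Fin.ext (by omega)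
      have h2 : b = b' := Fin.ext (by omega)
      rw [h1, h2]⟩
  let Ψ : (Fin (n/4) → Equiv.Perm (Fin 4)) →* Equiv.Perm (Fin n) :=
    (Equiv.Perm.viaEmbeddingHom emb).comp
      (Equiv.Perm.sigmaCongrRightHom (fun _ : Fin (n/4) => Fin 4))
  have hΨ : Function.Injective Ψ :=
    (Equiv.Perm.viaEmbeddingHom_injective emb).comp Equiv.Perm.sigmaCongrRightHom_injective
  let y : Finset (Fin (n/4)) → (Fin (n/4) → Equiv.Perm (Fin 4)) := fun I i =>
    if i ∈ I then c else 1
  have hy2 : ∀ I i, (y I ^ 2) i = if i ∈ I then c ^ 2 else 1 := by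
    intro I i
    simp only [Pi.pow_apply, y]
    split_ifs <;> simp
  let x : Finset (Fin (n/4)) → alternatingGroup (Fin n) := fun I =>
    ⟨Ψ (y I ^ 2), by
      rw [Equiv.Perm.mem_alternatingGroup, map_pow, map_pow]
      exact Int.units_sq _⟩
  refine ⟨x, ?_, ?_, ?_, ?_, ?_⟩
  · intro I J h
    have h1 := hΨ (congrArg Subtype.val h)
    ext i
    have h2 := congrFun h1 i
    rw [hy2, hy2] at h2
    by_cases hI : i ∈ I <;> by_cases hJ : i ∈ J <;> simp_all
  · apply Subtype.ext
    show Ψ (y ∅ ^ 2) = 1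
    have : y ∅ ^ 2 = 1 := by funext i; rw [hy2]; simp
    rw [this, map_one]
  · intro i I hi
    apply Subtype.ext
    show Ψ (y (insert i I) ^ 2) = Ψ (y {i} ^ 2) * Ψ (y I ^ 2)
    rw [← map_mul]
    congr 1
    funext j
    rw [Pi.mul_apply, hy2, hy2, hy2]
    by_cases h1 : j = i
    · subst h1; simp [hi]
    · simp [h1]
  · intro I J
    apply Subtype.ext
    show Ψ (y I ^ 2) * Ψ (y J ^ 2) = Ψ (y J ^ 2) * Ψ (y I ^ 2)
    rw [← map_mul, ← map_mul]
    congr 1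
    funext j
    rw [Pi.mul_apply, Pi.mul_apply, hy2, hy2]
    split_ifs <;> simp
  · intro I
    apply Subtype.ext
    show Ψ (y I ^ 2) * Ψ (y I ^ 2) = 1
    rw [← map_mul]
    have : y I ^ 2 * y I ^ 2 = 1 := by
      funext j
      rw [Pi.mul_apply, hy2]
      split_ifs
      · exact hc4
      · simp
    rw [this, map_one]

lemma dim_lower (n : ℕ) (V : Submodule ℝ (EuclideanSpace ℝ (alternatingGroup (Fin n))))
    (hV : TInv V) (hf : ∀ h, (∀ v ∈ V, tr h v = v) → h = 1) :
    n / 4 ≤ Module.finrank ℝ V := by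
  classical
  obtain ⟨x, hinj, hx0, hxi, hxc, hx2⟩ := exists_elem_abelian n
  let T : Fin (n/4) → V →ₗ[ℝ] V := fun i => (tr (x {i})).restrict (hV (x {i}))
  have hTa : ∀ i (v : V), ((T i v : V) : EuclideanSpace ℝ (alternatingGroup (Fin n))) = tr (x {i}) v :=
    fun i v => rfl
  have hinv : ∀ I, (x I)⁻¹ = x I := fun I => inv_eq_of_mul_eq_one_left (hx2 I)
  have hsym : ∀ i, (T i).IsSymmetric := by
    intro i u v
    show inner ℝ (tr (x {i}) (u : EuclideanSpace ℝ (alternatingGroup (Fin n)))) v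
      = inner ℝ (u : EuclideanSpace ℝ (alternatingGroup (Fin n))) (tr (x {i}) v)
    rw [inner_tr, hinv]
  have hcomm : Pairwise (Function.onFun Commute T) := by
    intro i j _
    apply LinearMap.ext
    intro v
    apply Subtype.ext
    show tr (x {i}) (tr (x {j}) v) = tr (x {j}) (tr (x {i}) v)
    rw [tr_tr, tr_tr, hxc]
  let W : (Fin (n/4) → ℝ) → Submodule ℝ V := fun χ => ⨅ j, Module.End.eigenspace (T j) (χ j)
  have hint : DirectSum.IsInternal W :=
    LinearMap.IsSymmetric.directSum_isInternal_of_pairwise_commute hsym hcomm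
  have hind := hint.submodule_iSupIndep
  have htop := hint.submodule_iSup_eq_top
  have hWi : ∀ χ, ∀ v ∈ W χ, ∀ i, tr (x {i}) (v : EuclideanSpace ℝ (alternatingGroup (Fin n)))
      = χ i • (v : EuclideanSpace ℝ (alternatingGroup (Fin n))) := by
    intro χ v hv i
    have := (Submodule.mem_iInf _).1 hv i
    rw [Module.End.mem_eigenspace_iff] at this
    exact congrArg Subtype.val this
  have hWI : ∀ χ, ∀ v ∈ W χ, ∀ I, tr (x I) (v : EuclideanSpace ℝ (alternatingGroup (Fin n)))
      = (∏ i ∈ I, χ i) • (v : EuclideanSpace ℝ (alternatingGroup (Fin n))) := by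
    intro χ v hv I
    induction I using Finset.induction_on with
    | empty => simp [hx0, tr_one]
    | insert i I hi ih =>
      rw [hxi i I hi, ← tr_tr, hWi χ v hv, map_smul, ih, smul_smul, Finset.prod_insert hi]
  have hχ : ∀ χ, W χ ≠ ⊥ → ∀ I, (∏ i ∈ I, χ i) = 1 ∨ (∏ i ∈ I, χ i) = -1 := by
    intro χ hne I
    obtain ⟨v, hv, hv0⟩ := Submodule.exists_mem_ne_zero_of_ne_bot hne
    have h1 := hWI χ v hv I
    have h2 : tr (x I) (tr (x I) (v : EuclideanSpace ℝ (alternatingGroup (Fin n)))) = v := by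
      rw [tr_tr, hx2, tr_one]
    rw [h1, map_smul, h1, smul_smul] at h2
    have hv0' : (v : EuclideanSpace ℝ (alternatingGroup (Fin n))) ≠ 0 := fun h => hv0 (Subtype.ext h)
    have h3 : (∏ i ∈ I, χ i) * (∏ i ∈ I, χ i) = 1 := by
      have : ((∏ i ∈ I, χ i) * (∏ i ∈ I, χ i) - 1) • (v : EuclideanSpace ℝ (alternatingGroup (Fin n))) = 0 := by
        rw [sub_smul, h2, one_smul, sub_self]
      rcases smul_eq_zero.1 this with h | h
      · linarith
      · exact absurd h hv0'
    exact mul_self_eq_one_iff.1 h3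
  letI : Fintype {χ // W χ ≠ ⊥} := hind.fintypeNeBotOfFiniteDimensional
  have hcard := hind.subtype_ne_bot_le_finrank
  refine le_trans ?_ hcard
  let Φ : Finset (Fin (n/4)) → ({χ // W χ ≠ ⊥} → Bool) := fun I χ =>
    decide ((∏ i ∈ I, χ.1 i) = 1)
  have hΦ : Function.Injective Φ := by
    intro I J hIJ
    apply hinj
    have hprod : ∀ χ, W χ ≠ ⊥ → (∏ i ∈ I, χ i) = ∏ i ∈ J, χ i := by
      intro χ hne
      have h1 := congrFun hIJ ⟨χ, hne⟩
      simp only [Φ, decide_eq_decide] at h1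
      rcases hχ χ hne I with hI | hI <;> rcases hχ χ hne J with hJ | hJ
      · rw [hI, hJ]
      · exact absurd (h1.1 hI) (by rw [hJ]; norm_num)
      · exact absurd (h1.2 hJ) (by rw [hI]; norm_num)
      · rw [hI, hJ]
    have hle : (⊤ : Submodule ℝ V) ≤ LinearMap.eqLocus ((tr (x I)).comp V.subtype)
        ((tr (x J)).comp V.subtype) := by
      rw [← htop]
      refine iSup_le (fun χ => ?_)
      intro v hv
      rw [LinearMap.mem_eqLocus]
      show tr (x I) (v : EuclideanSpace ℝ (alternatingGroup (Fin n))) = tr (x J) v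
      by_cases hb : W χ = ⊥
      · rw [hb, Submodule.mem_bot] at hv
        simp [hv]
      · rw [hWI χ v hv, hWI χ v hv, hprod χ hb]
    have h2 : x J * (x I)⁻¹ = 1 := by
      apply hf
      intro v hv
      have h3 : tr (x I) v = tr (x J) v := hle (x := ⟨v, hv⟩) trivial
      rw [← tr_tr, ← h3, tr_tr, mul_inv_cancel, tr_one]
    exact (mul_inv_eq_one.1 h2).symm
  have := Fintype.card_le_of_injective Φ hΦ
  simp only [Fintype.card_finset, Fintype.card_fin, Fintype.card_pi, Fintype.card_bool,
    Finset.prod_const, Finset.card_univ] at this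
  exact (Nat.pow_le_pow_iff_right (by norm_num)).1 this

lemma trivial_or_large (n : ℕ) (hn : 5 ≤ n)
    (V : Submodule ℝ (EuclideanSpace ℝ (alternatingGroup (Fin n)))) (hV : TInv V) :
    (∀ h, ∀ v ∈ V, tr h v = v) ∨ n / 4 ≤ Module.finrank ℝ V := by
  have : IsSimpleGroup (alternatingGroup (Fin n)) :=
    alternatingGroup.isSimpleGroup (by simpa using hn)
  let N : Subgroup (alternatingGroup (Fin n)) :=
    { carrier := {h | ∀ v ∈ V, tr h v = v}
      mul_mem' := by
        intro a b ha hb v hv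
        rw [← tr_tr, ha v hv, hb v hv]
      one_mem' := fun v _ => tr_one v
      inv_mem' := by
        intro a ha v hv
        conv_lhs => rw [← ha v hv]
        rw [tr_tr, mul_inv_cancel, tr_one] }
  have hN : N.Normal := by
    constructor
    intro a ha g v hv
    have ha : ∀ v ∈ V, tr a v = v := ha
    rw [← tr_tr, ← tr_tr, ha _ (hV g v hv), tr_tr, mul_inv_cancel, tr_one]
  rcases hN.eq_bot_or_eq_top with h | h
  · right
    refine dim_lower n V hV (fun a ha => ?_)
    have : a ∈ N := ha
    rwa [h, Subgroup.mem_bot] at this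
  · left
    intro a
    have : a ∈ N := by rw [h]; trivial
    exact this

lemma numeric (n d M p : ℕ) (hn : 100 ≤ n) (hd : n / 4 ≤ d) (hM : M ≤ n / 4)
    (hp : p = ⌈Real.log d⌉₊) (X t : ℝ) (ht : 0 ≤ t)
    (h : X ^ (2*p) ≤ d * M * (2*(4*p)^2*t/d)^p) :
    |X| ≤ 192 * Real.log n / Real.sqrt n * Real.sqrt t := by
  have hd25 : 25 ≤ d := by omega
  have hdr : (25:ℝ) ≤ d := by exact_mod_cast hd25
  have hd0 : (0:ℝ) < d := by linarith
  have he2 : Real.exp 2 ≤ 8 := by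
    have h1 : Real.exp 2 = Real.exp 1 * Real.exp 1 := by rw [← Real.exp_add]; norm_num
    have h2 := Real.exp_one_lt_d9
    have h3 := Real.exp_pos 1
    rw [h1]; nlinarith
  have hlog2 : 2 ≤ Real.log d := by
    rw [Real.le_log_iff_exp_le hd0]; linarith
  have hp1 : Real.log d ≤ p := hp ▸ Nat.le_ceil _
  have hp2 : (p:ℝ) ≤ 2 * Real.log d := by
    have := Nat.ceil_lt_add_one (by linarith : 0 ≤ Real.log d)
    rw [← hp] at this; linarith
  have hp0 : 2 ≤ p := by exact_mod_cast hlog2.trans hp1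
  have hMd : (M:ℝ) ≤ d := by exact_mod_cast hM.trans hd
  set T : ℝ := Real.exp 1 * Real.sqrt (2*(4*p)^2*t/d) with hT
  have hT0 : 0 ≤ T := by positivity
  have hq0 : 0 ≤ 2*(4*(p:ℝ))^2*t/d := by positivity
  have hT2 : T^(2*p) = Real.exp p ^ 2 * (2*(4*(p:ℝ))^2*t/d)^p := by
    rw [hT, mul_pow, pow_mul (Real.sqrt _), Real.sq_sqrt hq0, ← Real.exp_nat_mul, ← Real.exp_nat_mul]
    congr 2
    push_cast; ring
  have hexp : (d:ℝ) ≤ Real.exp p := by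
    rw [← Real.log_le_iff_le_exp hd0]; exact hp1
  have hXT : |X| ≤ T := by
    have h1 : |X|^(2*p) ≤ T^(2*p) := by
      rw [hT2, pow_mul, sq_abs, ← pow_mul]
      refine h.trans ?_
      gcongr
      rw [sq]
      exact mul_le_mul hexp (hMd.trans hexp) (by positivity) (by positivity)
    exact le_of_pow_le_pow_left₀ (by omega) hT0 h1
  refine hXT.trans ?_
  have hsq : Real.sqrt (2*(4*(p:ℝ))^2*t/d) = Real.sqrt 2 * (4*p) * Real.sqrt t / Real.sqrt d := by
    rw [Real.sqrt_div (by positivity), Real.sqrt_mul (by positivity), Real.sqrt_mul (by positivity),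
      Real.sqrt_sq (by positivity)]
  have hs2 : Real.sqrt 2 ≤ 1.5 := by
    rw [Real.sqrt_le_left (by norm_num)]; norm_num
  have he1 : Real.exp 1 ≤ 3 := by have := Real.exp_one_lt_d9; linarith
  set r : ℕ := n / 4 with hr
  have hr25 : (25:ℝ) ≤ r := by
    have : 25 ≤ r := by omega
    exact_mod_cast this
  have hanti : Real.log d / Real.sqrt d ≤ Real.log r / Real.sqrt r := by
    apply Real.log_div_sqrt_antitoneOn
    · exact he2.trans (by linarith)
    · exact he2.trans (by linarith)
    · exact_mod_cast hd
  have hnr : (n:ℝ) ≤ 5 * r := by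
    have : n ≤ 5 * r := by omega
    exact_mod_cast this
  have hrn : (r:ℝ) ≤ n := by
    have : r ≤ n := by omega
    exact_mod_cast this
  have hn0 : (0:ℝ) < n := by linarith
  have hr0 : (0:ℝ) < r := by linarith
  have hlast : Real.log r / Real.sqrt r ≤ 3 * Real.log n / Real.sqrt n := by
    have h1 : Real.log r ≤ Real.log n := Real.log_le_log hr0 hrn
    have h2 : Real.sqrt n ≤ 3 * Real.sqrt r := by
      rw [Real.sqrt_le_left (by positivity), mul_pow, Real.sq_sqrt hr0.le]
      linarith
    have h3 : 0 ≤ Real.log r := Real.log_nonneg (by linarith)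
    rw [div_le_div_iff₀ (Real.sqrt_pos.2 hr0) (Real.sqrt_pos.2 hn0)]
    calc Real.log r * Real.sqrt n ≤ Real.log n * (3 * Real.sqrt r) := by gcongr
      _ = _ := by ring
  have hsd : 0 < Real.sqrt d := Real.sqrt_pos.2 hd0
  calc T = Real.exp 1 * (Real.sqrt 2 * (4*p) * Real.sqrt t / Real.sqrt d) := by rw [hT, hsq]
    _ ≤ 3 * (1.5 * (4*(2 * Real.log d)) * Real.sqrt t / Real.sqrt d) := by gcongr
    _ = 36 * (Real.log d / Real.sqrt d) * Real.sqrt t := by ring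
    _ ≤ 36 * (3 * Real.log n / Real.sqrt n) * Real.sqrt t := by
        exact mul_le_mul_of_nonneg_right (mul_le_mul_of_nonneg_left (hanti.trans hlast)
          (by norm_num)) (Real.sqrt_nonneg _)
    _ = 108 * (Real.log n / Real.sqrt n) * Real.sqrt t := by ring
    _ ≤ 192 * (Real.log n / Real.sqrt n) * Real.sqrt t := by
        have : 0 ≤ Real.log n / Real.sqrt n :=
          div_nonneg (Real.log_nonneg (by linarith)) (Real.sqrt_nonneg _)
        gcongr; norm_num
    _ = _ := by ring

lemma basis_to_set {E : Type*} [NormedAddCommGroup E] [InnerProductSpace ℝ E]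
    (V : Submodule ℝ E) {ι : Type*} [Fintype ι] (b : OrthonormalBasis ι ℝ V) :
    Orthonormal ℝ ((↑) : (Set.range (fun k => (b k : E))) → E) ∧
      Submodule.span ℝ (Set.range (fun k => (b k : E))) = V := by
  have ho : Orthonormal ℝ (fun k => (b k : E)) :=
    b.orthonormal.comp_linearIsometry V.subtypeₗᵢ
  refine ⟨ho.toSubtypeRange, ?_⟩
  have h1 : Set.range (fun k => (b k : E)) = V.subtype '' (Set.range b) := by
    rw [← Set.range_comp]; rfl
  have h2 : Submodule.span ℝ (Set.range b) = ⊤ := by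
    rw [← b.coe_toBasis]; exact b.toBasis.span_eq
  rw [h1, Submodule.span_image, h2, Submodule.map_top, Submodule.range_subtype]

lemma real_main (n : ℕ) (hn : 100 ≤ n) (S : Finset (alternatingGroup (Fin n)))
    (hS : ∀ s ∈ S, s⁻¹ ∈ S) (M : ℕ) (hM : M ≤ n / 4)
    (f : Fin M → alternatingGroup (Fin n) → ℝ) :
    ∃ b : OrthonormalBasis (alternatingGroup (Fin n)) ℝ
          (EuclideanSpace ℝ (alternatingGroup (Fin n))),
      ∀ φ, (∃ μ : ℝ, ∀ g, ∑ s ∈ S, b φ (g * s) = μ * b φ g) ∧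
        ∀ i, |(∑ g, f i g * b φ g ^ 2) -
              (∑ g, f i g) / (Fintype.card (alternatingGroup (Fin n)) : ℝ)| ≤
            192 * Real.log n / Real.sqrt n *
              (Real.sqrt (∑ g : alternatingGroup (Fin n), f i g ^ 2) /
                Real.sqrt (Fintype.card (alternatingGroup (Fin n)))) := by
  have hG : (0:ℝ) < Fintype.card (alternatingGroup (Fin n)) := by exact_mod_cast Fintype.card_pos
  have hnr : (100:ℝ) ≤ n := by exact_mod_cast hn
  obtain ⟨s, hs, hspan, hP⟩ := decomp S hS (fun v => (∃ μ : ℝ, ∀ g, ∑ s ∈ S, v (g * s) = μ * v g) ∧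
        ∀ i, |(∑ g, f i g * v g ^ 2) -
              (∑ g, f i g) / (Fintype.card (alternatingGroup (Fin n)) : ℝ)| ≤
            192 * Real.log n / Real.sqrt n *
              (Real.sqrt (∑ g : alternatingGroup (Fin n), f i g ^ 2) /
                Real.sqrt (Fintype.card (alternatingGroup (Fin n))))) (by
    rintro V hV0 hV - ⟨μ, hμ⟩
    have hμ' : ∀ v ∈ V, ∃ μ : ℝ, ∀ g, ∑ s ∈ S, v (g * s) = μ * v g := by
      intro v hv
      refine ⟨μ, fun g => ?_⟩
      rw [← adj_apply, hμ v hv]; rfl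
    have hpos : 0 < Module.finrank ℝ V := by
      rw [Module.finrank_pos_iff]; exact Submodule.nontrivial_iff_ne_bot.2 hV0
    rcases trivial_or_large n (by omega) V hV with htriv | hlarge
    · let b := stdOrthonormalBasis ℝ V
      obtain ⟨h1, h2⟩ := basis_to_set V b
      refine ⟨_, h1, h2, ?_⟩
      rintro v ⟨k, rfl⟩
      refine ⟨hμ' _ (b k).2, fun i => ?_⟩
      have hc : ∀ g, (b k : EuclideanSpace ℝ (alternatingGroup (Fin n))) g
          = (b k : EuclideanSpace ℝ (alternatingGroup (Fin n))) 1 := by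
        intro g
        have := congrArg (fun w : EuclideanSpace ℝ (alternatingGroup (Fin n)) => w 1)
          (htriv g (b k) (b k).2)
        simpa [tr_apply] using this
      have hnorm : (b k : EuclideanSpace ℝ (alternatingGroup (Fin n))) 1 ^ 2
          = 1 / Fintype.card (alternatingGroup (Fin n)) := by
        have h3 : inner ℝ (b k : EuclideanSpace ℝ (alternatingGroup (Fin n))) (b k) = 1 := by
          rw [real_inner_self_eq_norm_sq,
            show ‖(b k : EuclideanSpace ℝ (alternatingGroup (Fin n)))‖ = 1 from b.orthonormal.1 k]
          norm_num
        rw [inner_eq] at h3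
        simp only [hc, Finset.sum_const, Finset.card_univ, nsmul_eq_mul] at h3
        rw [eq_div_iff hG.ne', ← h3]; ring
      have : (∑ g, f i g * (b k : EuclideanSpace ℝ (alternatingGroup (Fin n))) g ^ 2) -
              (∑ g, f i g) / (Fintype.card (alternatingGroup (Fin n)) : ℝ) = 0 := by
        simp only [hc, hnorm, ← Finset.sum_mul]
        ring
      rw [this, abs_zero]
      have : 0 ≤ Real.log n := Real.log_nonneg (by linarith)
      positivity
    · obtain ⟨b, hb⟩ := block V hV _ rfl hpos f ⌈Real.log (Module.finrank ℝ V : ℕ)⌉₊ (by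
        rw [Nat.one_le_ceil_iff]
        apply Real.log_pos
        have : 1 < Module.finrank ℝ V := by omega
        exact_mod_cast this)
      obtain ⟨h1, h2⟩ := basis_to_set V b
      refine ⟨_, h1, h2, ?_⟩
      rintro v ⟨k, rfl⟩
      refine ⟨hμ' _ (b k).2, fun i => ?_⟩
      have h3 := hb k i
      rw [Fintype.card_fin] at h3
      have hf0 : 0 ≤ ∑ g, f i g ^ 2 := Finset.sum_nonneg (fun _ _ => sq_nonneg _)
      rw [← Real.sqrt_div hf0]
      exact numeric n _ M _ hn hlarge hM rfl _ _ (by positivity) h3)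
  have hfin : s.Finite := hs.linearIndependent.setFinite
  have : Fintype s := hfin.fintype
  let b0 : OrthonormalBasis s ℝ (EuclideanSpace ℝ (alternatingGroup (Fin n))) :=
    OrthonormalBasis.mk hs (by simp [hspan])
  have hcard : Fintype.card s = Fintype.card (alternatingGroup (Fin n)) := by
    rw [← Module.finrank_eq_card_basis b0.toBasis]; simp
  let e : s ≃ alternatingGroup (Fin n) := Fintype.equivOfCardEq hcard
  refine ⟨b0.reindex e, fun φ => ?_⟩
  have : (b0.reindex e) φ = (e.symm φ : EuclideanSpace ℝ (alternatingGroup (Fin n))) := by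
    simp [b0]
  rw [this]
  exact hP _ (e.symm φ).2

lemma complexify {G : Type*} [Fintype G] [DecidableEq G]
    (b : OrthonormalBasis G ℝ (EuclideanSpace ℝ G)) :
    ∃ B : OrthonormalBasis G ℂ (EuclideanSpace ℂ G), ∀ φ g, B φ g = ((b φ g : ℝ) : ℂ) := by
  let v : G → EuclideanSpace ℂ G := fun φ => WithLp.toLp 2 (fun g => ((b φ g : ℝ) : ℂ))
  have hv : Orthonormal ℂ v := by
    rw [orthonormal_iff_ite]
    intro i j
    have := orthonormal_iff_ite.1 b.orthonormal i j
    rw [PiLp.inner_apply] at this ⊢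
    have h2 := congrArg (fun x : ℝ => (x : ℂ)) this
    simp only [v]
    have h3 : (((if i = j then (1:ℝ) else 0) : ℝ) : ℂ) = if i = j then (1:ℂ) else 0 := by
      split_ifs <;> simp
    rw [← h3, ← h2]
    simp
  obtain ⟨B, hB⟩ := Orthonormal.exists_orthonormalBasis_extension_of_card_eq (𝕜 := ℂ)
    (E := EuclideanSpace ℂ G) (ι := G) (by simp) (v := v) (s := Set.univ)
    (hv.comp _ Subtype.val_injective)
  exact ⟨B, fun φ g => by rw [hB φ (Set.mem_univ _)]⟩

/-- **QUE for Cayley graphs of alternating groups** (Proposition 1.6, `Alt(n)` case). -/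
theorem stmt_5
    (S : ∀ n : ℕ, Finset (alternatingGroup (Fin n)))
    (hS : ∀ n, ∀ s ∈ S n, s⁻¹ ∈ S n)
    (M : ℕ → ℕ) (hMpos : ∀ n, 0 < M n)
    (hM : Filter.Tendsto (fun n : ℕ => (M n : ℝ) / n) Filter.atTop (nhds 0))
    (f : ∀ n : ℕ, Fin (M n) → alternatingGroup (Fin n) → ℝ) :
    ∃ n₀ : ℕ, ∀ n, n₀ ≤ n →
      ∃ B : OrthonormalBasis (alternatingGroup (Fin n)) ℂ
          (EuclideanSpace ℂ (alternatingGroup (Fin n))),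
        (∀ φ : alternatingGroup (Fin n), (∀ g, (B φ g).im = 0) ∧
          ∃ μ : ℂ, ∀ g, ∑ s ∈ S n, B φ (g * s) = μ * B φ g) ∧
        (∀ (φ : alternatingGroup (Fin n)) (i : Fin (M n)),
          |(∑ g : alternatingGroup (Fin n), f n i g * ‖B φ g‖ ^ 2) -
              (∑ g : alternatingGroup (Fin n), f n i g) /
                (Fintype.card (alternatingGroup (Fin n)) : ℝ)| ≤
            192 * Real.log n / Real.sqrt n *
              (Real.sqrt (∑ g : alternatingGroup (Fin n), f n i g ^ 2) /
                Real.sqrt (Fintype.card (alternatingGroup (Fin n))))) := by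
  have hev := hM.eventually (gt_mem_nhds (by norm_num : (0:ℝ) < 1/8))
  obtain ⟨n1, hn1⟩ := Filter.eventually_atTop.1 hev
  refine ⟨max n1 100, fun n hn => ?_⟩
  have hn100 : 100 ≤ n := (le_max_right _ _).trans hn
  have hMn : M n ≤ n / 4 := by
    have h1 := hn1 n ((le_max_left _ _).trans hn)
    have hn0 : (0:ℝ) < n := by
      have : 0 < n := by omega
      exact_mod_cast this
    rw [div_lt_iff₀ hn0] at h1
    have h2 : (8 * M n : ℝ) < n := by linarith
    have h3 : 8 * M n < n := by exact_mod_cast h2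
    omega
  obtain ⟨b, hb⟩ := real_main n hn100 (S n) (hS n) (M n) hMn (f n)
  obtain ⟨B, hB⟩ := complexify b
  refine ⟨B, fun φ => ⟨fun g => ?_, ?_⟩, fun φ i => ?_⟩
  · rw [hB]; exact Complex.ofReal_im _
  · obtain ⟨μ, hμ⟩ := (hb φ).1
    refine ⟨(μ : ℂ), fun g => ?_⟩
    simp only [hB]
    rw [← Complex.ofReal_mul, ← hμ g]
    push_cast
    rfl
  · have := (hb φ).2 i
    simpa only [hB, Complex.norm_real, Real.norm_eq_abs, sq_abs] using this
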